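/- arXiv:1901.10427 — 2 statements merged into one kernel-verified Lean document; each statement's English description precedes it below -/
import Mathlib

section
/- Let N ≥ 3 and 2* = 2N/(N−2). Let (u_k)_{k∈ℕ} be a sequence in C_c^∞(ℝ^N) with sup_k ∫_{ℝ^N}(|∇u_k|² + u_k²) dx < ∞. Suppose there are sequences of points (y_k^{(n)}) in ℝ^N and integers (j_k^{(n)}) in ℕ with j_k^{(n)} → ∞, and functions w^{(n)} ∈ L^{2*}(ℝ^N) with weak gradients ∇w^{(n)} ∈ L²(ℝ^N; ℝ^N) satisfying Σ_{n∈ℕ} ∫ |∇w^{(n)}|² dx < ∞, such that: for each n, 2^{−j_k^{(n)}(N−2)/2} u_k(y_k^{(n)} + 2^{−j_k^{(n)}} ξ) → w^{(n)}(ξ) almost everywhere; for n ≠ n' the pairs (j_k^{(n)}, y_k^{(n)}) and (j_k^{(n')}, y_k^{(n')}) are asymptotically decoupled; and, with W_k^{(n)}(x) = 2^{j_k^{(n)}(N−2)/2} χ(x − y_k^{(n)}) w^{(n)}(2^{j_k^{(n)}}(x − y_k^{(n)})), for every ε > 0 there exist ν, K such that for all k ≥ K, (∫ |u_k − Σ_{n=1}^{ν}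 W_k^{(n)}|^{2*} dx)^{1/2*} < ε. Then ∫_{ℝ^N} |u_k|^{2*} dx → Σ_{n∈ℕ} ∫_{ℝ^N} |w^{(n)}|^{2*} dx as k → ∞. -/
open MeasureTheory Filter Topology
open scoped RealInnerProductSpace

noncomputable section

/-- A locally integrable function `w` on ℝ^N has weak gradient `g`. -/
def HasWeakGradient {N : ℕ} (w : EuclideanSpace ℝ (Fin N) → ℝ)
    (g : EuclideanSpace ℝ (Fin N) → EuclideanSpace ℝ (Fin N)) : Prop :=
  ∀ φ : EuclideanSpace ℝ (Fin N) → ℝ, ContDiff ℝ (⊤ : ℕ∞) φ → HasCompactSupport φ →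
    ∀ i : Fin N, (∫ x, w x * fderiv ℝ φ x (EuclideanSpace.single i 1)) = -∫ x, g x i * φ x

open scoped ENNReal

section Scaling

theorem measurableEmbedding_add_smul {V : Type*} [NormedAddCommGroup V] [NormedSpace ℝ V]
    [MeasurableSpace V] [BorelSpace V] (z : V) {b : ℝ} (hb : b ≠ 0) :
    MeasurableEmbedding (fun ξ : V => z + b • ξ) :=
  (measurableEmbedding_addLeft z).comp (measurableEmbedding_const_smul₀ hb)

variable {V : Type*} [NormedAddCommGroup V] [NormedSpace ℝ V] [FiniteDimensional ℝ V]
  [MeasurableSpace V] [BorelSpace V] (μ : Measure V) [μ.IsAddHaarMeasure]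

theorem map_add_smul_addHaar (z : V) {b : ℝ} (hb : b ≠ 0) :
    μ.map (fun ξ => z + b • ξ) = ENNReal.ofReal |(b ^ Module.finrank ℝ V)⁻¹| • μ := by
  have h : (fun ξ : V => z + b • ξ) = (fun x => z + x) ∘ (fun ξ => b • ξ) := rfl
  rw [h, ← Measure.map_map (by fun_prop) (by fun_prop), Measure.map_addHaar_smul μ hb,
    Measure.map_smul, map_add_left_eq_self]

theorem quasiMeasurePreserving_add_smul (z : V) {b : ℝ} (hb : b ≠ 0) :
    Measure.QuasiMeasurePreserving (fun ξ : V => z + b • ξ) μ μ := by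
  refine ⟨by fun_prop, ?_⟩
  rw [map_add_smul_addHaar μ z hb]
  exact Measure.smul_absolutelyContinuous

theorem setLIntegral_preimage_add_inv_smul (z : V) {a : ℝ} (ha : 0 < a) {s : Set V}
    (f : V → ℝ≥0∞) :
    ∫⁻ ξ in (fun ξ => z + a⁻¹ • ξ) ⁻¹' s, f (z + a⁻¹ • ξ) ∂μ =
      ENNReal.ofReal (a ^ Module.finrank ℝ V) * ∫⁻ x in s, f x ∂μ := by
  have he := measurableEmbedding_add_smul z (inv_ne_zero ha.ne')
  rw [← he.lintegral_map (μ := μ.restrict _) f, ← he.restrict_map,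
    map_add_smul_addHaar μ z (inv_ne_zero ha.ne'), Measure.restrict_smul,
    lintegral_smul_measure, inv_pow, inv_inv, abs_of_pos (by positivity), smul_eq_mul]

/-- Critical rescaling preserves the `p`-mass of `u` on every set. -/
theorem setLIntegral_rescale (z : V) {a c p : ℝ} (ha : 0 < a) (hc : 0 < c) (hp : 0 < p)
    (hcp : c ^ p = a ^ Module.finrank ℝ V) (u : V → ℝ) (s : Set V) :
    ∫⁻ ξ in (fun ξ => z + a⁻¹ • ξ) ⁻¹' s, ‖c⁻¹ * u (z + a⁻¹ • ξ)‖ₑ ^ p ∂μ =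
      ∫⁻ x in s, ‖u x‖ₑ ^ p ∂μ := by
  have h0 : ENNReal.ofReal (a ^ Module.finrank ℝ V) ≠ 0 := by simp; positivity
  have h1 : ∀ t : ℝ, ‖c⁻¹ * t‖ₑ ^ p =
      (ENNReal.ofReal (a ^ Module.finrank ℝ V))⁻¹ * ‖t‖ₑ ^ p := fun t => by
    rw [enorm_mul, ENNReal.mul_rpow_of_nonneg _ _ hp.le, ← hcp, enorm_inv hc.ne',
      ENNReal.inv_rpow, Real.enorm_eq_ofReal hc.le, ENNReal.ofReal_rpow_of_pos hc]
  simp_rw [h1]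
  rw [lintegral_const_mul' _ _ (by simpa using h0), setLIntegral_preimage_add_inv_smul μ z ha
    (fun x => ‖u x‖ₑ ^ p), ← mul_assoc, ENNReal.inv_mul_cancel h0 ENNReal.ofReal_ne_top, one_mul]

theorem setLIntegral_bubble_le (z : V) {a c p : ℝ} (ha : 0 < a) (hc : 0 < c) (hp : 0 < p)
    (hcp : c ^ p = a ^ Module.finrank ℝ V) {χ : V → ℝ} (hχ : ∀ x, 0 ≤ χ x ∧ χ x ≤ 1)
    (w : V → ℝ) (s : Set V) :
    ∫⁻ x in s, ‖c * χ (x - z) * w (a • (x - z))‖ₑ ^ p ∂μ ≤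
      ∫⁻ ξ in (fun ξ => z + a⁻¹ • ξ) ⁻¹' s, ‖w ξ‖ₑ ^ p ∂μ := by
  rw [← setLIntegral_rescale μ z ha hc hp hcp]
  refine lintegral_mono fun ξ => ?_
  refine ENNReal.rpow_le_rpow ?_ hp.le
  rw [add_sub_cancel_left, smul_inv_smul₀ ha.ne', mul_assoc, inv_mul_cancel_left₀ hc.ne',
    enorm_mul]
  refine mul_le_of_le_one_left' ?_
  rw [Real.enorm_eq_ofReal (hχ _).1]
  simpa using (hχ _).2

theorem aestronglyMeasurable_bubble (z : V) {a : ℝ} (ha : 0 < a) (c : ℝ) {χ w : V → ℝ}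
    (hχ : Continuous χ) (hw : AEStronglyMeasurable w μ) :
    AEStronglyMeasurable (fun x => c * χ (x - z) * w (a • (x - z))) μ := by
  have h := hw.comp_quasiMeasurePreserving
    (quasiMeasurePreserving_add_smul μ (-(a • z)) ha.ne')
  have h2 : (w ∘ fun ξ => -(a • z) + a • ξ) = fun x => w (a • (x - z)) := by
    funext x; simp only [Function.comp, smul_sub]; congr 1; abel
  rw [h2] at h
  have : Continuous fun x => c * χ (x - z) := by fun_prop
  exact this.aestronglyMeasurable.mul h

end Scaling

section Regions

variable {V : Type*} [NormedAddCommGroup V]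

/-- The ball of radius `R` of the `n`-th bubble among the first `ν`, deprived of the balls of the
bubbles with a finer scale. -/
def bubbleRegion (y : ℕ → V) (j : ℕ → ℕ) (R : ℝ) (ν n : ℕ) : Set V :=
  Metric.closedBall (y n) (R / 2 ^ j n) \
    ⋃ m ∈ (Finset.range ν).filter (fun m => j n < j m), Metric.closedBall (y m) (R / 2 ^ j m)

theorem measurableSet_bubbleRegion [MeasurableSpace V] [BorelSpace V]
    (y : ℕ → V) (j : ℕ → ℕ) (R : ℝ) (ν n : ℕ) : MeasurableSet (bubbleRegion y j R ν n) :=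
  measurableSet_closedBall.diff
    (Finset.measurableSet_biUnion _ fun _ _ => measurableSet_closedBall)

theorem disjoint_closedBall_of_decoupled {x z : V} {i l : ℕ} {R : ℝ} {M : ℕ} (hR : 0 ≤ R)
    (hil : i ≤ l) (hlM : l < i + M)
    (h : M + R * (3 + 2 ^ M) < |(l : ℝ) - i| + (2 ^ l + 2 ^ i) * ‖x - z‖) :
    Disjoint (Metric.closedBall x (R / 2 ^ i)) (Metric.closedBall z (R / 2 ^ l)) := by
  rw [Set.disjoint_left]
  intro p hp hq
  rw [mem_closedBall_iff_norm] at hp hq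
  have h1 : ‖x - z‖ ≤ R / 2 ^ i + R / 2 ^ l := by
    calc ‖x - z‖ = ‖(p - z) - (p - x)‖ := by congr 1; abel
      _ ≤ ‖p - z‖ + ‖p - x‖ := norm_sub_le _ _
      _ ≤ _ := by linarith
  obtain ⟨d, rfl⟩ := Nat.exists_eq_add_of_le hil
  have hd : d < M := by omega
  have h2 : (2 : ℝ) ^ d ≤ 2 ^ M := pow_le_pow_right₀ (by norm_num) hd.le
  have h3 : ((2 : ℝ) ^ d)⁻¹ ≤ 1 := inv_le_one_of_one_le₀ (one_le_pow₀ (by norm_num))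
  have h4 : |((i + d : ℕ) : ℝ) - i| ≤ M := by
    push_cast; rw [add_sub_cancel_left, abs_of_nonneg (by positivity)]; exact_mod_cast hd.le
  have h5 : ((2 : ℝ) ^ (i + d) + 2 ^ i) * (R / 2 ^ i + R / 2 ^ (i + d)) =
      R * (2 + 2 ^ d + (2 ^ d)⁻¹) := by
    rw [pow_add]; field_simp; ring
  have h6 : ((2 : ℝ) ^ (i + d) + 2 ^ i) * ‖x - z‖ ≤ R * (3 + 2 ^ M) := by
    refine (mul_le_mul_of_nonneg_left h1 (by positivity)).trans ?_
    rw [h5]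
    exact mul_le_mul_of_nonneg_left (by linarith) hR
  linarith

variable {y : ℕ → ℕ → V} {j : ℕ → ℕ → ℕ}

theorem eventually_pairwiseDisjoint_bubbleRegion
    (hdec : ∀ n n', n ≠ n' →
      Tendsto (fun k => |(j n' k : ℝ) - (j n k : ℝ)| +
          ((2 : ℝ) ^ (j n' k) + (2 : ℝ) ^ (j n k)) * ‖y n k - y n' k‖) atTop atTop)
    {R : ℝ} (hR : 0 ≤ R) (ν : ℕ) :
    ∀ᶠ k in atTop, Set.PairwiseDisjoint (Finset.range ν : Set ℕ)
      (bubbleRegion (fun n => y n k) (fun n => j n k) R ν) := by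
  have key : ∀ n ∈ Finset.range ν, ∀ m ∈ Finset.range ν, ∀ᶠ k in atTop, n ≠ m →
      Disjoint (bubbleRegion (fun n => y n k) (fun n => j n k) R ν n)
        (bubbleRegion (fun n => y n k) (fun n => j n k) R ν m) := by
    intro n hn m hm
    rcases eq_or_ne n m with rfl | hnm
    · simp
    filter_upwards [(hdec n m hnm).eventually_gt_atTop (((1 : ℕ) : ℝ) + R * (3 + 2 ^ 1))]
      with k hk _
    rcases lt_trichotomy (j n k) (j m k) with hlt | heq | hlt
    · refine (Set.disjoint_left.2 fun x hx hx' => hx.2 ?_)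
      exact Set.mem_biUnion (x := m) (by simpa using ⟨by simpa using hm, hlt⟩) hx'.1
    · exact (disjoint_closedBall_of_decoupled hR heq.le (by omega) hk).mono
        Set.sdiff_subset Set.sdiff_subset
    · refine (Set.disjoint_left.2 fun x hx hx' => hx'.2 ?_)
      exact Set.mem_biUnion (x := n) (by simpa using ⟨by simpa using hn, hlt⟩) hx.1
  simp_rw [← eventually_all_finset] at key
  filter_upwards [key] with k hk
  intro n hn m hm hnm
  exact hk n hn m hm hnm

variable [NormedSpace ℝ V] [FiniteDimensional ℝ V] [MeasurableSpace V] [BorelSpace V]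
  (μ : Measure V) [μ.IsAddHaarMeasure]

theorem tendsto_addHaar_closedBall_div_two_pow [Nontrivial V] {R : ℝ} (hR : 0 ≤ R) :
    Tendsto (fun M : ℕ => μ (Metric.closedBall (0 : V) (R / 2 ^ M))) atTop (𝓝 0) := by
  have h1 : Tendsto (fun M : ℕ => R / 2 ^ M) atTop (𝓝 0) :=
    tendsto_const_nhds.div_atTop (tendsto_pow_atTop_atTop_of_one_lt (by norm_num))
  have h2 : Tendsto (fun M : ℕ => ENNReal.ofReal ((R / 2 ^ M) ^ Module.finrank ℝ V) *
      μ (Metric.ball (0 : V) 1)) atTop (𝓝 (ENNReal.ofReal (0 ^ Module.finrank ℝ V) *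
      μ (Metric.ball (0 : V) 1))) :=
    ENNReal.Tendsto.mul_const (ENNReal.tendsto_ofReal (h1.pow _)) (Or.inr measure_ball_lt_top.ne)
  rw [zero_pow Module.finrank_pos.ne', ENNReal.ofReal_zero, zero_mul] at h2
  refine h2.congr fun M => ?_
  rw [Measure.addHaar_closedBall _ _ (by positivity)]

/-- In the coordinates of the `n`-th bubble, the part of the ball removed from its region has
vanishing measure. -/
theorem tendsto_addHaar_closedBall_diff_bubbleRegion [Nontrivial V]
    (hdec : ∀ n n', n ≠ n' →
      Tendsto (fun k => |(j n' k : ℝ) - (j n k : ℝ)| +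
          ((2 : ℝ) ^ (j n' k) + (2 : ℝ) ^ (j n k)) * ‖y n k - y n' k‖) atTop atTop)
    {R : ℝ} (hR : 0 ≤ R) (ν n : ℕ) :
    Tendsto (fun k => μ (Metric.closedBall 0 R \
      (fun ξ => y n k + ((2 : ℝ) ^ j n k)⁻¹ • ξ) ⁻¹'
        bubbleRegion (fun n => y n k) (fun n => j n k) R ν n)) atTop (𝓝 0) := by
  set S : ℕ → V → V := fun k ξ => y n k + ((2 : ℝ) ^ j n k)⁻¹ • ξ with hS
  set D : ℕ → ℕ → Set V := fun m k => {ξ | ξ ∈ Metric.closedBall 0 R ∧ j n k < j m k ∧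
    S k ξ ∈ Metric.closedBall (y m k) (R / 2 ^ j m k)} with hD
  have hSball : ∀ k, ∀ ξ ∈ Metric.closedBall (0 : V) R,
      S k ξ ∈ Metric.closedBall (y n k) (R / 2 ^ j n k) := by
    intro k ξ hξ
    rw [mem_closedBall_zero_iff] at hξ
    rw [mem_closedBall_iff_norm, hS]
    simp only [add_sub_cancel_left, norm_smul, norm_inv, norm_pow, Real.norm_ofNat]
    rw [inv_mul_eq_div]
    gcongr
  have hsub : ∀ k, Metric.closedBall 0 R \ S k ⁻¹'
      bubbleRegion (fun n => y n k) (fun n => j n k) R ν n ⊆ ⋃ m ∈ Finset.range ν, D m k := by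
    rintro k ξ ⟨h1, h2⟩
    simp only [bubbleRegion, Set.preimage_sdiff, Set.mem_sdiff, Set.mem_preimage, hSball k ξ h1,
      true_and, not_not, Set.mem_iUnion, Finset.mem_filter, exists_prop] at h2
    obtain ⟨m, ⟨hm, hjm⟩, hx⟩ := h2
    exact Set.mem_biUnion (x := m) (by simpa using hm) ⟨h1, hjm, hx⟩
  have hDlim : ∀ m ∈ Finset.range ν, Tendsto (fun k => μ (D m k)) atTop (𝓝 0) := by
    intro m _
    rcases eq_or_ne n m with rfl | hnm
    · simp [hD]
    rw [ENNReal.tendsto_nhds_zero]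
    intro ε hε
    obtain ⟨M, hM⟩ := (ENNReal.tendsto_nhds_zero.1
      (tendsto_addHaar_closedBall_div_two_pow μ hR) ε hε).exists
    filter_upwards [(hdec n m hnm).eventually_gt_atTop ((M : ℝ) + R * (3 + 2 ^ M))] with k hk
    by_cases hjj : j m k < j n k + M
    · have : D m k = ∅ := by
        refine Set.eq_empty_of_forall_notMem fun ξ hξ => ?_
        exact Set.disjoint_left.1 (disjoint_closedBall_of_decoupled hR hξ.2.1.le hjj hk)
          (hSball k ξ hξ.1) hξ.2.2
      simp [this]
    · refine (measure_mono (t := Metric.closedBall (((2 : ℝ) ^ j n k) • (y m k - y n k))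
        (R / 2 ^ M)) ?_).trans ?_
      · rintro ξ ⟨-, -, h⟩
        obtain ⟨d, hd⟩ := Nat.exists_eq_add_of_le (not_lt.1 hjj)
        rw [mem_closedBall_iff_norm] at h ⊢
        have h1 : ξ - ((2 : ℝ) ^ j n k) • (y m k - y n k) =
            ((2 : ℝ) ^ j n k) • (S k ξ - y m k) := by
          have h2 : S k ξ - y m k = ((2 : ℝ) ^ j n k)⁻¹ • ξ - (y m k - y n k) := by
            simp only [hS]; abel
          rw [h2, smul_sub _ (((2 : ℝ) ^ j n k)⁻¹ • ξ), smul_inv_smul₀ (by positivity)]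
        rw [h1, norm_smul, norm_pow, Real.norm_ofNat]
        refine (mul_le_mul_of_nonneg_left h (by positivity)).trans ?_
        rw [hd, pow_add, pow_add, div_mul_eq_div_div, div_mul_eq_div_div,
          mul_div_assoc', mul_div_assoc', mul_div_cancel₀ _ (by positivity)]
        exact div_le_self (by positivity) (one_le_pow₀ (by norm_num))
      · rwa [Measure.addHaar_closedBall_center]
  have hsum := tendsto_finsetSum (Finset.range ν) hDlim
  rw [Finset.sum_const_zero] at hsum
  refine tendsto_of_tendsto_of_tendsto_of_le_of_le tendsto_const_nhds hsum
    (fun _ => zero_le) fun k => ?_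
  exact (measure_mono (hsub k)).trans (measure_biUnion_finset_le _ _)

end Regions

section CriticalMass

theorem lintegral_sum_indicator_rpow {X ι : Type*} [MeasurableSpace X]
    (μ : Measure X) {p : ℝ} {s : Finset ι} {E : ι → Set X}
    (hE : Set.PairwiseDisjoint (s : Set ι) E) (hm : ∀ i, MeasurableSet (E i)) (hp : 0 < p)
    (f : ι → X → ℝ) :
    ∫⁻ x, ‖(∑ i ∈ s, (E i).indicator (f i)) x‖ₑ ^ p ∂μ ≤ ∑ i ∈ s, ∫⁻ x in E i, ‖f i x‖ₑ ^ p ∂μ := by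
  have hz : ∀ x, x ∉ ⋃ i ∈ s, E i → ‖(∑ i ∈ s, (E i).indicator (f i)) x‖ₑ ^ p = 0 := by
    intro x hx
    rw [Finset.sum_apply, Finset.sum_eq_zero, enorm_zero, ENNReal.zero_rpow_of_pos hp]
    intro i hi
    exact Set.indicator_of_notMem (fun h => hx (Set.mem_biUnion (x := i) hi h)) _
  rw [← setLIntegral_eq_of_support_subset (s := ⋃ i ∈ s, E i)]
  · rw [lintegral_biUnion_finset hE fun i _ => hm i]
    refine Finset.sum_le_sum fun i hi => ?_
    refine setLIntegral_mono_ae' (hm i) (ae_of_all _ fun x hx => ?_)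
    rw [Finset.sum_apply, Finset.sum_eq_single i, Set.indicator_of_mem hx]
    · intro l hl hli
      exact Set.indicator_of_notMem (fun h => Set.disjoint_left.1 (hE hl hi hli) h hx) _
    · exact fun h => (h hi).elim
  · exact fun x hx => by_contra fun h => hx (hz x h)

theorem tendsto_setLIntegral_closedBall_min {V : Type*} [NormedAddCommGroup V]
    [MeasurableSpace V] [BorelSpace V] (μ : Measure V) {f : V → ℝ≥0∞} (hf : AEMeasurable f μ) :
    Tendsto (fun R : ℕ => ∫⁻ x in Metric.closedBall 0 (R : ℝ), min (f x) R ∂μ) atTop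
      (𝓝 (∫⁻ x, f x ∂μ)) := by
  simp_rw [← lintegral_indicator measurableSet_closedBall]
  refine lintegral_tendsto_of_tendsto_of_monotone (fun R => ?_) (ae_of_all _ fun x => ?_)
    (ae_of_all _ fun x => ?_)
  · exact (hf.min aemeasurable_const).indicator measurableSet_closedBall
  · intro R R' hRR'
    have h : (R : ℝ) ≤ R' := by exact_mod_cast hRR'
    have h' : (R : ℝ≥0∞) ≤ R' := by exact_mod_cast hRR'
    refine (Set.indicator_le_indicator_of_subset (Metric.closedBall_subset_closedBall h)
      (fun _ => zero_le) x).trans (Set.indicator_le_indicator ?_)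
    exact min_le_min_left _ h'
  · have h1 : Tendsto (fun R : ℕ => min (f x) (R : ℝ≥0∞)) atTop (𝓝 (min (f x) ⊤)) :=
      tendsto_const_nhds.min ENNReal.tendsto_nat_nhds_top
    rw [min_top_right] at h1
    refine h1.congr' ?_
    filter_upwards [eventually_ge_atTop ⌈‖x‖⌉₊] with R hR
    rw [Set.indicator_of_mem]
    rw [mem_closedBall_zero_iff]
    exact Nat.ceil_le.1 hR

theorem tendsto_setLIntegral_compl_closedBall {V : Type*} [NormedAddCommGroup V]
    [MeasurableSpace V] [BorelSpace V] (μ : Measure V) {f : V → ℝ≥0∞} (hf : AEMeasurable f μ)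
    (hfin : ∫⁻ x, f x ∂μ ≠ ∞) :
    Tendsto (fun R : ℕ => ∫⁻ x in (Metric.closedBall 0 (R : ℝ))ᶜ, f x ∂μ) atTop (𝓝 0) := by
  simp_rw [← lintegral_indicator measurableSet_closedBall.compl]
  have h := tendsto_lintegral_of_dominated_convergence' (μ := μ)
    (F := fun R : ℕ => (Metric.closedBall (0 : V) (R : ℝ))ᶜ.indicator f) (f := fun _ => 0) f
    (fun R => hf.indicator measurableSet_closedBall.compl)
    (fun R => ae_of_all _ fun x => Set.indicator_le_self _ _ x) hfin
    (ae_of_all _ fun x => ?_)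
  · simpa using h
  · refine tendsto_const_nhds.congr' ?_
    filter_upwards [eventually_ge_atTop ⌈‖x‖⌉₊] with R hR
    rw [Set.indicator_of_notMem]
    rw [Set.mem_compl_iff, not_not, mem_closedBall_zero_iff]
    exact Nat.ceil_le.1 hR

variable {V : Type*} [NormedAddCommGroup V] [NormedSpace ℝ V] [FiniteDimensional ℝ V]
  [MeasurableSpace V] [BorelSpace V] (μ : Measure V) [μ.IsAddHaarMeasure]

variable {y : ℕ → ℕ → V} {j : ℕ → ℕ → ℕ} {c : ℕ → ℕ → ℝ} {p : ℝ} {w : ℕ → V → ℝ}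

/-- The mass of a sequence asymptotically dominates the sum of the masses of any finite number
of its decoupled profiles. -/
theorem eventually_lt_lintegral_of_profiles [Nontrivial V]
    (hdec : ∀ n n', n ≠ n' →
      Tendsto (fun k => |(j n' k : ℝ) - (j n k : ℝ)| +
          ((2 : ℝ) ^ (j n' k) + (2 : ℝ) ^ (j n k)) * ‖y n k - y n' k‖) atTop atTop)
    (hp : 0 < p) (hc : ∀ n k, 0 < c n k)
    (hcp : ∀ n k, c n k ^ p = ((2 : ℝ) ^ j n k) ^ Module.finrank ℝ V)
    {u : ℕ → V → ℝ} (hu : ∀ k, Measurable (u k)) (hw : ∀ n, AEStronglyMeasurable (w n) μ)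
    (hae : ∀ n, ∀ᵐ ξ ∂μ, Tendsto (fun k => (c n k)⁻¹ * u k (y n k + ((2 : ℝ) ^ (j n k))⁻¹ • ξ))
      atTop (𝓝 (w n ξ)))
    (ν : ℕ) {t : ℝ≥0∞} (ht : t < ∑ n ∈ Finset.range ν, ∫⁻ ξ, ‖w n ξ‖ₑ ^ p ∂μ) :
    ∀ᶠ k in atTop, t < ∫⁻ x, ‖u k x‖ₑ ^ p ∂μ := by
  have hlim := tendsto_finsetSum (Finset.range ν) fun n _ =>
    tendsto_setLIntegral_closedBall_min μ ((hw n).enorm.pow_const p)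
  obtain ⟨R, hR⟩ := (hlim.eventually_const_lt ht).exists
  obtain ⟨t', htt', ht'⟩ := exists_between hR
  set B : Set V := Metric.closedBall 0 (R : ℝ) with hB
  set v : ℕ → ℕ → V → ℝ := fun n k ξ => (c n k)⁻¹ * u k (y n k + ((2 : ℝ) ^ (j n k))⁻¹ • ξ)
    with hv
  set E : ℕ → ℕ → Set V := fun n k => bubbleRegion (fun n => y n k) (fun n => j n k) R ν n with hE
  set F : ℕ → ℕ → Set V := fun n k => (fun ξ => y n k + ((2 : ℝ) ^ j n k)⁻¹ • ξ) ⁻¹' E n k with hF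
  have hvm : ∀ n k, Measurable (v n k) := fun n k =>
    ((hu k).comp (by fun_prop)).const_mul _
  have h1 : Tendsto (fun k => ∑ n ∈ Finset.range ν, ∫⁻ ξ in B, min (‖v n k ξ‖ₑ ^ p) R ∂μ) atTop
      (𝓝 (∑ n ∈ Finset.range ν, ∫⁻ ξ in B, min (‖w n ξ‖ₑ ^ p) R ∂μ)) := by
    refine tendsto_finsetSum _ fun n _ => ?_
    refine tendsto_lintegral_of_dominated_convergence' (fun _ => (R : ℝ≥0∞))
      (fun k => (((hvm n k).enorm.pow_const p).min measurable_const).aemeasurable)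
      (fun k => ae_of_all _ fun ξ => min_le_right _ _) ?_ ?_
    · rw [setLIntegral_const]
      exact ENNReal.mul_ne_top (ENNReal.natCast_ne_top R) measure_closedBall_lt_top.ne
    · filter_upwards [ae_restrict_of_ae (hae n)] with ξ hξ
      exact (((ENNReal.continuous_rpow_const.tendsto _).comp hξ.enorm).min tendsto_const_nhds)
  have h2 : Tendsto (fun k => ∑ n ∈ Finset.range ν, (R : ℝ≥0∞) * μ (B \ F n k)) atTop (𝓝 0) := by
    have := tendsto_finsetSum (Finset.range ν) fun n _ =>
      ENNReal.Tendsto.const_mul (a := (R : ℝ≥0∞))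
        (tendsto_addHaar_closedBall_diff_bubbleRegion μ hdec R.cast_nonneg ν n)
        (Or.inr (ENNReal.natCast_ne_top R))
    simpa using this
  filter_upwards [h1.eventually_const_lt ht', h2.eventually_lt_const (tsub_pos_of_lt htt'),
    eventually_pairwiseDisjoint_bubbleRegion hdec R.cast_nonneg ν] with k hk1 hk2 hk3
  by_contra! hle
  have hmF : ∀ n, MeasurableSet (F n k) := fun n =>
    (measurableSet_bubbleRegion _ _ _ _ _).preimage (by fun_prop)
  have h3 : ∀ n, ∫⁻ ξ in B, min (‖v n k ξ‖ₑ ^ p) R ∂μ ≤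
      ∫⁻ x in E n k, ‖u k x‖ₑ ^ p ∂μ + R * μ (B \ F n k) := by
    intro n
    rw [← setLIntegral_rescale μ (y n k) (by positivity) (hc n k) hp (hcp n k),
      ← lintegral_inter_add_sdiff _ B (hmF n), ← setLIntegral_const]
    refine add_le_add ?_ (lintegral_mono fun ξ => min_le_right _ _)
    exact (lintegral_mono_set Set.inter_subset_right).trans
      (lintegral_mono fun ξ => min_le_left _ _)
  have h4 : ∑ n ∈ Finset.range ν, ∫⁻ x in E n k, ‖u k x‖ₑ ^ p ∂μ ≤ t := by
    rw [← lintegral_biUnion_finset hk3 fun n _ => measurableSet_bubbleRegion _ _ _ _ _]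
    exact (setLIntegral_le_lintegral _ _).trans hle
  have h5 := hk1.trans_le (Finset.sum_le_sum fun n _ => h3 n)
  rw [Finset.sum_add_distrib] at h5
  have h6 := h5.trans_le (add_le_add h4 hk2.le)
  rw [add_tsub_cancel_of_le htt'.le] at h6
  exact h6.false

/-- The norm of a finite sum of decoupled bubbles is asymptotically at most the `ℓ^p` sum of the
norms of the profiles. -/
theorem eventually_eLpNorm_sum_bubble_le [Nontrivial V]
    (hdec : ∀ n n', n ≠ n' →
      Tendsto (fun k => |(j n' k : ℝ) - (j n k : ℝ)| +
          ((2 : ℝ) ^ (j n' k) + (2 : ℝ) ^ (j n k)) * ‖y n k - y n' k‖) atTop atTop)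
    (hp : 1 ≤ p) (hc : ∀ n k, 0 < c n k)
    (hcp : ∀ n k, c n k ^ p = ((2 : ℝ) ^ j n k) ^ Module.finrank ℝ V)
    {χ : V → ℝ} (hχc : Continuous χ) (hχ : ∀ x, 0 ≤ χ x ∧ χ x ≤ 1)
    (hw : ∀ n, AEStronglyMeasurable (w n) μ) (hfin : ∀ n, ∫⁻ ξ, ‖w n ξ‖ₑ ^ p ∂μ ≠ ∞)
    (ν : ℕ) {ε : ℝ≥0∞} (hε : 0 < ε) :
    ∀ᶠ k in atTop, eLpNorm (fun x => ∑ n ∈ Finset.range ν,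
        c n k * χ (x - y n k) * w n ((2 : ℝ) ^ j n k • (x - y n k))) (ENNReal.ofReal p) μ ≤
      (∑ n ∈ Finset.range ν, ∫⁻ ξ, ‖w n ξ‖ₑ ^ p ∂μ) ^ (1 / p) + ε := by
  have hp0 : 0 < p := by linarith
  have hq : (ENNReal.ofReal p).toReal = p := ENNReal.toReal_ofReal hp0.le
  have hnorm : ∀ f : V → ℝ, eLpNorm f (ENNReal.ofReal p) μ = (∫⁻ x, ‖f x‖ₑ ^ p ∂μ) ^ (1 / p) :=
    fun f => by
      rw [eLpNorm_eq_lintegral_rpow_enorm_toReal (by simpa using hp0) ENNReal.ofReal_ne_top, hq]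
  have hrt : (0 : ℝ≥0∞) ^ (1 / p) = 0 := ENNReal.zero_rpow_of_pos (by positivity)
  have htail : Tendsto (fun R : ℕ => ∑ n ∈ Finset.range ν,
      (∫⁻ ξ in (Metric.closedBall 0 (R : ℝ))ᶜ, ‖w n ξ‖ₑ ^ p ∂μ) ^ (1 / p)) atTop (𝓝 0) := by
    have := tendsto_finsetSum (Finset.range ν) fun n _ =>
      (ENNReal.continuous_rpow_const (y := 1 / p)).tendsto 0 |>.comp
        (tendsto_setLIntegral_compl_closedBall μ ((hw n).enorm.pow_const p) (hfin n))
    simpa [hrt, Function.comp_def, hp0] using this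
  obtain ⟨R, hR⟩ := (htail.eventually_lt_const hε).exists
  set B : Set V := Metric.closedBall 0 (R : ℝ) with hB
  set E : ℕ → ℕ → Set V := fun n k => bubbleRegion (fun n => y n k) (fun n => j n k) R ν n with hE
  set F : ℕ → ℕ → Set V := fun n k => (fun ξ => y n k + ((2 : ℝ) ^ j n k)⁻¹ • ξ) ⁻¹' E n k with hF
  set W : ℕ → ℕ → V → ℝ := fun n k x =>
    c n k * χ (x - y n k) * w n ((2 : ℝ) ^ j n k • (x - y n k)) with hW
  have hmE : ∀ n k, MeasurableSet (E n k) := fun n k => measurableSet_bubbleRegion _ _ _ _ _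
  have hmW : ∀ n k, AEStronglyMeasurable (W n k) μ := fun n k =>
    aestronglyMeasurable_bubble μ _ (by positivity) _ hχc (hw n)
  have herr : Tendsto (fun k => ∑ n ∈ Finset.range ν, (∫⁻ ξ in Bᶜ, ‖w n ξ‖ₑ ^ p ∂μ +
      ∫⁻ ξ in B \ F n k, ‖w n ξ‖ₑ ^ p ∂μ) ^ (1 / p)) atTop
      (𝓝 (∑ n ∈ Finset.range ν, (∫⁻ ξ in Bᶜ, ‖w n ξ‖ₑ ^ p ∂μ) ^ (1 / p))) := by
    refine tendsto_finsetSum _ fun n _ => ?_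
    refine (ENNReal.continuous_rpow_const.tendsto _).comp ?_
    have := (tendsto_const_nhds (x := ∫⁻ ξ in Bᶜ, ‖w n ξ‖ₑ ^ p ∂μ)).add
      (tendsto_setLIntegral_zero (hfin n)
        (tendsto_addHaar_closedBall_diff_bubbleRegion μ hdec R.cast_nonneg ν n))
    rwa [add_zero] at this
  filter_upwards [herr.eventually_lt_const hR,
    eventually_pairwiseDisjoint_bubbleRegion hdec R.cast_nonneg ν] with k hk1 hk2
  have hsplit : (fun x => ∑ n ∈ Finset.range ν, W n k x) =
      (∑ n ∈ Finset.range ν, (E n k).indicator (W n k)) +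
        ∑ n ∈ Finset.range ν, (E n k)ᶜ.indicator (W n k) := by
    rw [← Finset.sum_add_distrib]
    simp_rw [Set.indicator_self_add_compl]
    ext x; simp
  have hle : ∀ n s, ∫⁻ x in s, ‖W n k x‖ₑ ^ p ∂μ ≤
      ∫⁻ ξ in (fun ξ => y n k + ((2 : ℝ) ^ j n k)⁻¹ • ξ) ⁻¹' s, ‖w n ξ‖ₑ ^ p ∂μ := fun n s =>
    setLIntegral_bubble_le μ _ (by positivity) (hc n k) hp0 (hcp n k) hχ _ s
  rw [hsplit]
  refine (eLpNorm_add_le ?_ ?_ (by simpa using hp)).trans (add_le_add ?_ ?_)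
  · exact Finset.aestronglyMeasurable_sum _ fun n _ => (hmW n k).indicator (hmE n k)
  · exact Finset.aestronglyMeasurable_sum _ fun n _ => (hmW n k).indicator (hmE n k).compl
  · rw [hnorm]
    refine ENNReal.rpow_le_rpow ?_ (by positivity)
    refine (lintegral_sum_indicator_rpow μ hk2 (fun n => hmE n k) hp0 _).trans ?_
    exact Finset.sum_le_sum fun n _ => (hle n _).trans (setLIntegral_le_lintegral _ _)
  · refine (eLpNorm_sum_le (fun n _ => (hmW n k).indicator (hmE n k).compl)
      (by simpa using hp)).trans (le_trans (Finset.sum_le_sum fun n _ => ?_) hk1.le)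
    rw [eLpNorm_indicator_eq_eLpNorm_restrict (hmE n k).compl,
      eLpNorm_eq_lintegral_rpow_enorm_toReal (by simpa using hp0) ENNReal.ofReal_ne_top, hq]
    refine ENNReal.rpow_le_rpow ((hle n _).trans ?_) (by positivity)
    refine (lintegral_mono_set (t := Bᶜ ∪ B \ F n k) fun ξ hξ => ?_).trans
      (lintegral_union_le _ _ _)
    by_cases h : ξ ∈ B
    · exact Or.inr ⟨h, hξ⟩
    · exact Or.inl h

/-- Convergence of the masses, when the remainder after finitely many bubbles can be made
arbitrarily small. -/
theorem tendsto_lintegral_of_profile_decomposition [Nontrivial V]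
    (hdec : ∀ n n', n ≠ n' →
      Tendsto (fun k => |(j n' k : ℝ) - (j n k : ℝ)| +
          ((2 : ℝ) ^ (j n' k) + (2 : ℝ) ^ (j n k)) * ‖y n k - y n' k‖) atTop atTop)
    (hp : 1 ≤ p) (hc : ∀ n k, 0 < c n k)
    (hcp : ∀ n k, c n k ^ p = ((2 : ℝ) ^ j n k) ^ Module.finrank ℝ V)
    {χ : V → ℝ} (hχc : Continuous χ) (hχ : ∀ x, 0 ≤ χ x ∧ χ x ≤ 1)
    {u : ℕ → V → ℝ} (hu : ∀ k, Measurable (u k))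
    (hw : ∀ n, AEStronglyMeasurable (w n) μ) (hfin : ∀ n, ∫⁻ ξ, ‖w n ξ‖ₑ ^ p ∂μ ≠ ∞)
    (hae : ∀ n, ∀ᵐ ξ ∂μ, Tendsto (fun k => (c n k)⁻¹ * u k (y n k + ((2 : ℝ) ^ (j n k))⁻¹ • ξ))
      atTop (𝓝 (w n ξ)))
    (hrem : ∀ ε : ℝ≥0∞, 0 < ε → ∃ ν : ℕ, ∀ᶠ k in atTop,
      eLpNorm (fun x => u k x - ∑ n ∈ Finset.range ν,
        c n k * χ (x - y n k) * w n ((2 : ℝ) ^ j n k • (x - y n k))) (ENNReal.ofReal p) μ ≤ ε) :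
    ∑' n, ∫⁻ ξ, ‖w n ξ‖ₑ ^ p ∂μ ≠ ∞ ∧
      Tendsto (fun k => ∫⁻ x, ‖u k x‖ₑ ^ p ∂μ) atTop (𝓝 (∑' n, ∫⁻ ξ, ‖w n ξ‖ₑ ^ p ∂μ)) := by
  have hp0 : 0 < p := by linarith
  have hq : (ENNReal.ofReal p).toReal = p := ENNReal.toReal_ofReal hp0.le
  set A := ∑' n, ∫⁻ ξ, ‖w n ξ‖ₑ ^ p ∂μ with hA
  have hSA : ∀ ν, ∑ n ∈ Finset.range ν, ∫⁻ ξ, ‖w n ξ‖ₑ ^ p ∂μ ≤ A := fun ν =>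
    ENNReal.sum_le_tsum _
  have hlow : ∀ t < A, ∀ᶠ k in atTop, t < ∫⁻ x, ‖u k x‖ₑ ^ p ∂μ := by
    intro t ht
    rw [hA, ENNReal.tsum_eq_iSup_nat, lt_iSup_iff] at ht
    obtain ⟨ν, hν⟩ := ht
    exact eventually_lt_lintegral_of_profiles μ hdec hp0 hc hcp hu hw hae ν hν
  have hup : ∀ ε : ℝ≥0∞, 0 < ε → ∃ ν : ℕ, ∀ᶠ k in atTop, (∫⁻ x, ‖u k x‖ₑ ^ p ∂μ) ^ (1 / p) ≤
      (∑ n ∈ Finset.range ν, ∫⁻ ξ, ‖w n ξ‖ₑ ^ p ∂μ) ^ (1 / p) + ε := by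
    intro ε hε
    have hε2 : 0 < ε / 2 := ENNReal.half_pos hε.ne'
    obtain ⟨ν, hν⟩ := hrem (ε / 2) hε2
    refine ⟨ν, ?_⟩
    filter_upwards [hν, eventually_eLpNorm_sum_bubble_le μ hdec hp hc hcp hχc hχ hw hfin ν hε2]
      with k hk1 hk2
    have hmW : AEStronglyMeasurable (fun x => ∑ n ∈ Finset.range ν,
        c n k * χ (x - y n k) * w n ((2 : ℝ) ^ j n k • (x - y n k))) μ :=
      Finset.aestronglyMeasurable_fun_sum _ fun n _ =>
        aestronglyMeasurable_bubble μ _ (by positivity) _ hχc (hw n)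
    have h := eLpNorm_add_le ((hu k).aestronglyMeasurable.sub hmW) hmW
      (p := ENNReal.ofReal p) (by simpa using hp)
    rw [sub_add_cancel] at h
    have h' := h.trans (add_le_add hk1 hk2)
    rw [eLpNorm_eq_lintegral_rpow_enorm_toReal (by simpa using hp0) ENNReal.ofReal_ne_top, hq,
      add_left_comm, ENNReal.add_halves] at h'
    exact h'
  have hAfin : A ≠ ∞ := by
    obtain ⟨ν, hν⟩ := hup 1 one_pos
    intro hAtop
    have hfin' : (∑ n ∈ Finset.range ν, ∫⁻ ξ, ‖w n ξ‖ₑ ^ p ∂μ) ^ (1 / p) + 1 ≠ ∞ :=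
      ENNReal.add_ne_top.2 ⟨ENNReal.rpow_ne_top_of_nonneg (by positivity)
        (ENNReal.sum_ne_top.2 fun n _ => hfin n), ENNReal.one_ne_top⟩
    obtain ⟨k, hk1, hk2⟩ := (hν.and (hlow
      (((∑ n ∈ Finset.range ν, ∫⁻ ξ, ‖w n ξ‖ₑ ^ p ∂μ) ^ (1 / p) + 1) ^ p)
      (hAtop ▸ (ENNReal.rpow_ne_top_of_nonneg hp0.le hfin').lt_top))).exists
    rw [one_div, ENNReal.rpow_inv_le_iff hp0, ← one_div] at hk1
    exact hk2.not_ge hk1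
  refine ⟨hAfin, tendsto_order.2 ⟨hlow, fun t ht => ?_⟩⟩
  have hroot : A ^ (1 / p) < t ^ (1 / p) := ENNReal.rpow_lt_rpow ht (by positivity)
  obtain ⟨s, hs1, hs2⟩ := exists_between hroot
  obtain ⟨ν, hν⟩ := hup (s - A ^ (1 / p)) (tsub_pos_of_lt hs1)
  filter_upwards [hν] with k hk
  have h1 := hk.trans (add_le_add_left
    (ENNReal.rpow_le_rpow (hSA ν) (by positivity : 0 ≤ 1 / p)) _)
  rw [add_tsub_cancel_of_le hs1.le] at h1
  exact (ENNReal.rpow_lt_rpow_iff (by positivity : 0 < 1 / p)).1 (h1.trans_lt hs2)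

end CriticalMass

/-- Proposition 3.4 of the paper in ℝ^N: the critical mass of the sequence
converges to the sum of the critical masses of its profiles. -/
theorem struwe_solimini_stmt12 (N : ℕ) (hN : 3 ≤ N) (r : ℝ) (hr : 0 < r)
    (χ : EuclideanSpace ℝ (Fin N) → ℝ) (hχsm : ContDiff ℝ (⊤ : ℕ∞) χ) (hχc : HasCompactSupport χ)
    (hχ01 : ∀ x, 0 ≤ χ x ∧ χ x ≤ 1)
    (hχ1 : ∀ x : EuclideanSpace ℝ (Fin N), ‖x‖ ≤ r / 2 → χ x = 1)
    (hχ0 : ∀ x : EuclideanSpace ℝ (Fin N), r ≤ ‖x‖ → χ x = 0)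
    (u : ℕ → EuclideanSpace ℝ (Fin N) → ℝ)
    (hsm : ∀ k, ContDiff ℝ (⊤ : ℕ∞) (u k)) (hsupp : ∀ k, HasCompactSupport (u k))
    (hbd : ∃ C : ℝ, ∀ k, (∫ x, (‖gradient (u k) x‖ ^ 2 + (u k x) ^ 2)) ≤ C)
    (y : ℕ → ℕ → EuclideanSpace ℝ (Fin N)) (j : ℕ → ℕ → ℕ)
    (w : ℕ → EuclideanSpace ℝ (Fin N) → ℝ)
    (g : ℕ → EuclideanSpace ℝ (Fin N) → EuclideanSpace ℝ (Fin N))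
    (hjlim : ∀ n, Tendsto (j n) atTop atTop)
    (hwLp : ∀ n, Integrable (fun x => |w n x| ^ ((2 * (N : ℝ)) / ((N : ℝ) - 2))))
    (hwloc : ∀ n, LocallyIntegrable (w n))
    (hwg : ∀ n, HasWeakGradient (w n) (g n))
    (hgL2 : ∀ n, Integrable (fun x => ‖g n x‖ ^ 2))
    (hsum : Summable (fun n => ∫ x, ‖g n x‖ ^ 2))
    (hae : ∀ n, ∀ᵐ ξ : EuclideanSpace ℝ (Fin N),
      Tendsto (fun k => ((2 : ℝ) ^ ((j n k : ℝ) * (((N : ℝ) - 2) / 2)))⁻¹ *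
          u k (y n k + ((2 : ℝ) ^ (j n k))⁻¹ • ξ)) atTop (𝓝 (w n ξ)))
    (hdec : ∀ n n', n ≠ n' →
      Tendsto (fun k => |(j n' k : ℝ) - (j n k : ℝ)| +
          ((2 : ℝ) ^ (j n' k) + (2 : ℝ) ^ (j n k)) * ‖y n k - y n' k‖) atTop atTop)
    (hrem : ∀ ε : ℝ, 0 < ε → ∃ ν K : ℕ, ∀ k, K ≤ k →
      (∫ x, |u k x - ∑ n ∈ Finset.range ν,
          (2 : ℝ) ^ ((j n k : ℝ) * (((N : ℝ) - 2) / 2)) * χ (x - y n k) *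
            w n ((2 : ℝ) ^ (j n k) • (x - y n k))| ^ ((2 * (N : ℝ)) / ((N : ℝ) - 2)))
        ^ (((N : ℝ) - 2) / (2 * (N : ℝ))) < ε) :
    Tendsto (fun k => ∫ x, |u k x| ^ ((2 * (N : ℝ)) / ((N : ℝ) - 2))) atTop
      (𝓝 (∑' n, ∫ x, |w n x| ^ ((2 * (N : ℝ)) / ((N : ℝ) - 2)))) := by
  have hN' : (3 : ℝ) ≤ N := by exact_mod_cast hN
  set p : ℝ := (2 * (N : ℝ)) / ((N : ℝ) - 2) with hp
  have hN2 : 0 < (N : ℝ) - 2 := by linarith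
  have hp0 : 0 < p := by positivity
  have hp1 : 1 ≤ p := by rw [hp, le_div_iff₀ hN2]; linarith
  have hpinv : ((N : ℝ) - 2) / (2 * (N : ℝ)) = p⁻¹ := by rw [hp, inv_div]
  have hq : (ENNReal.ofReal p).toReal = p := ENNReal.toReal_ofReal hp0.le
  have hq0 : ENNReal.ofReal p ≠ 0 := by simpa using hp0
  have : Nontrivial (EuclideanSpace ℝ (Fin N)) := by
    refine Module.nontrivial_of_finrank_pos (R := ℝ) ?_
    rw [finrank_euclideanSpace_fin]; omega
  set c : ℕ → ℕ → ℝ := fun n k => (2 : ℝ) ^ ((j n k : ℝ) * (((N : ℝ) - 2) / 2)) with hc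
  have hc0 : ∀ n k, 0 < c n k := fun n k => by positivity
  have hcp : ∀ n k, c n k ^ p =
      ((2 : ℝ) ^ j n k) ^ Module.finrank ℝ (EuclideanSpace ℝ (Fin N)) := by
    intro n k
    rw [finrank_euclideanSpace_fin, ← pow_mul, ← Real.rpow_mul (by norm_num), ← Real.rpow_natCast]
    congr 1
    rw [hp]; push_cast; field_simp
  have hw : ∀ n, AEStronglyMeasurable (w n) volume := fun n => (hwloc n).aestronglyMeasurable
  have hrpow : ∀ s : ℝ, ‖s‖ₑ ^ p = ENNReal.ofReal (|s| ^ p) := fun s => by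
    rw [← Real.norm_eq_abs, ← ofReal_norm, ENNReal.ofReal_rpow_of_nonneg (norm_nonneg _) hp0.le]
  have hwmem : ∀ n, MemLp (w n) (ENNReal.ofReal p) volume := fun n => by
    rw [← integrable_norm_rpow_iff (hw n) hq0 ENNReal.ofReal_ne_top, hq]
    exact hwLp n
  have hmass : ∀ f : EuclideanSpace ℝ (Fin N) → ℝ, AEStronglyMeasurable f volume →
      ∫ x, |f x| ^ p = (∫⁻ x, ‖f x‖ₑ ^ p).toReal := fun f hf => by
    rw [integral_eq_lintegral_of_nonneg_ae (ae_of_all _ fun x => by positivity)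
      (hf.aemeasurable.abs.pow_const p).aestronglyMeasurable]
    simp_rw [hrpow]
  have hfin : ∀ n, ∫⁻ ξ, ‖w n ξ‖ₑ ^ p ≠ ∞ := fun n => by
    have h := lintegral_rpow_enorm_lt_top_of_eLpNorm_lt_top hq0 ENNReal.ofReal_ne_top
      (hwmem n).eLpNorm_lt_top
    rw [hq] at h
    exact h.ne
  have hbmem : ∀ n k, MemLp (fun x => c n k * χ (x - y n k) *
      w n ((2 : ℝ) ^ j n k • (x - y n k))) (ENNReal.ofReal p) volume := fun n k => by
    refine ⟨aestronglyMeasurable_bubble _ _ (by positivity) _ hχsm.continuous (hw n), ?_⟩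
    rw [eLpNorm_lt_top_iff_lintegral_rpow_enorm_lt_top hq0 ENNReal.ofReal_ne_top, hq,
      ← setLIntegral_univ]
    exact ((setLIntegral_bubble_le volume (y n k) (by positivity) (hc0 n k) hp0 (hcp n k) hχ01
      (w n) Set.univ).trans (setLIntegral_le_lintegral _ _)).trans_lt (hfin n).lt_top
  have humem : ∀ k, MemLp (u k) (ENNReal.ofReal p) volume := fun k =>
    (hsm k).continuous.memLp_of_hasCompactSupport (hsupp k)
  obtain ⟨hA, hlim⟩ := tendsto_lintegral_of_profile_decomposition volume hdec hp1 hc0 hcp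
    hχsm.continuous hχ01 (fun k => (hsm k).continuous.measurable) hw hfin hae (by
      intro ε hε
      obtain ⟨δ, hδ0, hδ⟩ := ENNReal.lt_iff_exists_real_btwn.1 hε
      have hδpos : 0 < δ := by simpa using hδ.1
      obtain ⟨ν, K, hK⟩ := hrem δ hδpos
      refine ⟨ν, eventually_atTop.2 ⟨K, fun k hk => le_trans ?_ hδ.2.le⟩⟩
      have hmem : MemLp (fun x => u k x - ∑ n ∈ Finset.range ν, c n k * χ (x - y n k) *
          w n ((2 : ℝ) ^ j n k • (x - y n k))) (ENNReal.ofReal p) volume :=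
        (humem k).sub (memLp_finsetSum _ fun n _ => hbmem n k)
      rw [hmem.eLpNorm_eq_integral_rpow_norm hq0 ENNReal.ofReal_ne_top, hq, ← hpinv]
      exact ENNReal.ofReal_le_ofReal (hK k hk).le)
  have hgoal := (ENNReal.tendsto_toReal hA).comp hlim
  rw [ENNReal.tsum_toReal_eq hfin] at hgoal
  simp_rw [hmass _ (hw _), hmass _ (hsm _).continuous.aestronglyMeasurable]
  exact hgoal
end
end

section
/- Let N ≥ 3, 2* = 2N/(N−2), and ν ∈ ℕ. For n = 1, …, ν let w^{(n)} be continuous compactly supported functions on ℝ^N, let (j_k^{(n)}) be sequences in ℕ with j_k^{(n)} → ∞, and let (y_k^{(n)}) be sequences in ℝ^N such that for all n ≠ n' the pairs (j_k^{(n)}, y_k^{(n)}) and (j_k^{(n')}, y_k^{(n')}) are asymptotically decoupled. Then, with W_k^{(n)}(x) = 2^{j_k^{(n)}(N−2)/2} χ(x − y_k^{(n)}) w^{(n)}(2^{j_k^{(n)}}(x − y_k^{(n)})), one has ∫_{ℝ^N} |Σ_{n=1}^{ν} W_k^{(n)}|^{2*} dx − Σ_{n=1}^{ν} ∫_{ℝ^N}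 |W_k^{(n)}|^{2*} dx → 0 as k → ∞. -/
open MeasureTheory Filter Topology
open scoped RealInnerProductSpace

noncomputable section

/-- The function `t ↦ t ^ p` has Lipschitz constant `p * K ^ (p - 1)` on `[0, K]`. -/
lemma abs_rpow_sub_rpow_le {p K s t : ℝ} (hp : 1 ≤ p) (hs : 0 ≤ s) (hsK : s ≤ K)
    (ht : 0 ≤ t) (htK : t ≤ K) :
    |s ^ p - t ^ p| ≤ p * K ^ (p - 1) * |s - t| := by
  have h := (convex_Icc (0 : ℝ) K).norm_image_sub_le_of_norm_hasDerivWithin_le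
    (f := fun x : ℝ => x ^ p) (f' := fun x => p * x ^ (p - 1)) (C := p * K ^ (p - 1))
    (fun x _ => (Real.hasDerivAt_rpow_const (Or.inr hp)).hasDerivWithinAt)
    (fun x hx => by
      rw [Real.norm_of_nonneg (mul_nonneg (by linarith) (Real.rpow_nonneg hx.1 _))]
      exact mul_le_mul_of_nonneg_left
        (Real.rpow_le_rpow hx.1 hx.2 (by linarith)) (by linarith))
    ⟨ht, htK⟩ ⟨hs, hsK⟩
  simpa [Real.norm_eq_abs] using h

/-- The `p`-th power of a finite sum differs from the sum of the `p`-th powers by mixed terms. -/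
lemma abs_abs_sum_rpow_sub_sum_abs_rpow_le {ι : Type*} [Fintype ι] [DecidableEq ι]
    {p : ℝ} (hp : 1 ≤ p) (a : ι → ℝ) :
    |(|∑ n, a n| ^ p - ∑ n, |a n| ^ p)| ≤
      (p * (Fintype.card ι : ℝ) ^ (p - 1) + 1) *
        ∑ m, ∑ n ∈ Finset.univ.erase m, |a m| ^ (p - 1) * |a n| := by
  have hp0 : p ≠ 0 := by linarith
  cases isEmpty_or_nonempty ι with
  | inl h => simp [Real.zero_rpow hp0]
  | inr h =>
    obtain ⟨m, hm⟩ := Finite.exists_max (fun n => |a n|)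
    have hcard : (1 : ℝ) ≤ Fintype.card ι := by exact_mod_cast Fintype.card_pos
    have hsum : |∑ n, a n| ≤ Fintype.card ι * |a m| := by
      refine (Finset.abs_sum_le_sum_abs _ _).trans ?_
      refine (Finset.sum_le_sum fun n _ => hm n).trans ?_
      simp
    have hmK : |a m| ≤ Fintype.card ι * |a m| := le_mul_of_one_le_left (abs_nonneg _) hcard
    have hdiff : |(|∑ n, a n| - |a m|)| ≤ ∑ n ∈ Finset.univ.erase m, |a n| := by
      refine (abs_abs_sub_abs_le _ _).trans ?_
      rw [← Finset.add_sum_erase _ _ (Finset.mem_univ m), add_sub_cancel_left]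
      exact Finset.abs_sum_le_sum_abs _ _
    have h1 : |(|∑ n, a n| ^ p - |a m| ^ p)| ≤ p * (Fintype.card ι : ℝ) ^ (p - 1) *
        ∑ n ∈ Finset.univ.erase m, |a m| ^ (p - 1) * |a n| := by
      refine (abs_rpow_sub_rpow_le hp (abs_nonneg _) hsum (abs_nonneg _) hmK).trans ?_
      rw [Real.mul_rpow (by positivity) (abs_nonneg _), ← Finset.mul_sum, ← mul_assoc,
        ← mul_assoc]
      gcongr
    have h2 : ∑ n ∈ Finset.univ.erase m, |a n| ^ p ≤
        ∑ n ∈ Finset.univ.erase m, |a m| ^ (p - 1) * |a n| := by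
      refine Finset.sum_le_sum fun n _ => ?_
      have : |a n| ^ p = |a n| ^ (p - 1) * |a n| := by
        rw [← Real.rpow_add_one' (abs_nonneg _) (by simpa using hp0), sub_add_cancel]
      rw [this]
      exact mul_le_mul_of_nonneg_right
        (Real.rpow_le_rpow (abs_nonneg _) (hm n) (by linarith)) (abs_nonneg _)
    have h3 : ∑ n ∈ Finset.univ.erase m, |a m| ^ (p - 1) * |a n| ≤
        ∑ m, ∑ n ∈ Finset.univ.erase m, |a m| ^ (p - 1) * |a n| :=
      Finset.single_le_sum (f := fun m => ∑ n ∈ Finset.univ.erase m, |a m| ^ (p - 1) * |a n|)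
        (fun _ _ => Finset.sum_nonneg fun _ _ => by positivity) (Finset.mem_univ m)
    have h0 : 0 ≤ ∑ n ∈ Finset.univ.erase m, |a n| ^ p :=
      Finset.sum_nonneg fun _ _ => by positivity
    rw [← Finset.add_sum_erase _ (fun n => |a n| ^ p) (Finset.mem_univ m), ← sub_sub]
    refine (abs_sub _ _).trans ?_
    rw [abs_of_nonneg h0]
    refine (add_le_add h1 h2).trans ?_
    rw [← add_one_mul]
    exact mul_le_mul_of_nonneg_left h3 (by positivity)

/-- If two balls of radii `R * 2 ^ (-i)` and `R * 2 ^ (-l)` meet, then the decoupling quantity of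
their scales and centres is controlled by the ratio of the scales. -/
lemma decoupling_le_of_closedBall_inter {E : Type*} [SeminormedAddCommGroup E]
    {R : ℝ} (hR : 0 ≤ R) (i l : ℕ) {x y z : E}
    (hy : x ∈ Metric.closedBall y (R / 2 ^ i)) (hz : x ∈ Metric.closedBall z (R / 2 ^ l)) :
    |(l : ℝ) - i| + ((2 : ℝ) ^ l + 2 ^ i) * ‖y - z‖ ≤
      (4 * R + 1) * (2 : ℝ) ^ |(l : ℝ) - i| := by
  wlog hil : i ≤ l generalizing i l y z
  · have := this l i hz hy (by omega)
    rwa [abs_sub_comm, norm_sub_rev, add_comm ((2 : ℝ) ^ l)]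
  obtain ⟨d, rfl⟩ := Nat.exists_eq_add_of_le hil
  have hd : |((i + d : ℕ) : ℝ) - i| = d := by push_cast; simp
  rw [hd, Real.rpow_natCast]
  have hdist : ‖y - z‖ ≤ R / 2 ^ i + R / 2 ^ (i + d) := by
    rw [← dist_eq_norm]
    exact (dist_triangle_left y z x).trans (add_le_add hy hz)
  have hd1 : (d : ℝ) ≤ 2 ^ d := by exact_mod_cast Nat.lt_two_pow_self.le
  have hd2 : (1 : ℝ) ≤ 2 ^ d := one_le_pow₀ (by norm_num)
  have hprod : ((2 : ℝ) ^ (i + d) + 2 ^ i) * ‖y - z‖ ≤ R * (2 + 2 ^ d + 1 / 2 ^ d) := by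
    refine (mul_le_mul_of_nonneg_left hdist (by positivity)).trans (le_of_eq ?_)
    rw [pow_add]
    field_simp
    ring
  have hinv : 1 / (2 : ℝ) ^ d ≤ 1 := by rw [div_le_one (by positivity)]; exact hd2
  nlinarith [mul_le_mul_of_nonneg_left hinv hR, mul_le_mul_of_nonneg_left hd2 hR]

/-- Balance of heights and volumes for two bubbles of scales `2 ^ i` and `2 ^ l`. -/
lemma two_rpow_mul_min_le {N : ℕ} {a p : ℝ} (ha : 0 ≤ a) (hp : 2 ≤ p) (hpa : p * a = N)
    (i l : ℕ) :
    ((2 : ℝ) ^ (i * a)) ^ (p - 1) * (2 : ℝ) ^ (l * a) *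
        min ((1 / (2 : ℝ) ^ i) ^ N) ((1 / (2 : ℝ) ^ l) ^ N) ≤
      ((2 : ℝ) ^ |(l : ℝ) - i|) ^ (-a) := by
  have hpow (n : ℕ) : (1 / (2 : ℝ) ^ n) ^ N = (2 : ℝ) ^ (-(n * (p * a))) := by
    rw [Real.rpow_neg (by norm_num), hpa, ← Nat.cast_mul, Real.rpow_natCast, pow_mul]
    simp
  rw [hpow, hpow, ← Real.rpow_mul (by norm_num), ← Real.rpow_mul (by norm_num),
    ← Real.rpow_add (by norm_num)]
  rcases le_total (i : ℝ) l with h | h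
  · refine (mul_le_mul_of_nonneg_left (min_le_right _ _) (by positivity)).trans ?_
    rw [← Real.rpow_add (by norm_num), abs_of_nonneg (by linarith)]
    refine Real.rpow_le_rpow_of_exponent_le (by norm_num) ?_
    nlinarith [mul_nonneg (mul_nonneg (sub_nonneg.2 h) ha) (sub_nonneg.2 hp)]
  · refine (mul_le_mul_of_nonneg_left (min_le_left _ _) (by positivity)).trans ?_
    rw [← Real.rpow_add (by norm_num), abs_of_nonpos (by linarith)]
    exact Real.rpow_le_rpow_of_exponent_le (by norm_num) (by nlinarith)

/-- The mixed term of two bubbles is controlled by a negative power of the decoupling quantity. -/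
lemma integral_mixed_bubbles_le {N : ℕ} {a p R M : ℝ} (ha : 0 ≤ a) (hp : 2 ≤ p)
    (hpa : p * a = N) (hR : 0 ≤ R) (hM : 0 ≤ M) (i l : ℕ) (y z : EuclideanSpace ℝ (Fin N))
    {f g : EuclideanSpace ℝ (Fin N) → ℝ}
    (hf : ∀ x, |f x| ≤ (2 : ℝ) ^ (i * a) * M) (hg : ∀ x, |g x| ≤ (2 : ℝ) ^ (l * a) * M)
    (hf0 : ∀ x, x ∉ Metric.closedBall y (R / 2 ^ i) → f x = 0)
    (hg0 : ∀ x, x ∉ Metric.closedBall z (R / 2 ^ l) → g x = 0)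
    (hS : 0 < |(l : ℝ) - i| + ((2 : ℝ) ^ l + 2 ^ i) * ‖y - z‖) :
    ∫ x, |f x| ^ (p - 1) * |g x| ≤
      M ^ (p - 1) * M * R ^ N *
          volume.real (Metric.closedBall (0 : EuclideanSpace ℝ (Fin N)) 1) *
        ((|(l : ℝ) - i| + ((2 : ℝ) ^ l + 2 ^ i) * ‖y - z‖) / (4 * R + 1)) ^ (-a) := by
  set S := |(l : ℝ) - i| + ((2 : ℝ) ^ l + 2 ^ i) * ‖y - z‖
  set V := volume.real (Metric.closedBall (0 : EuclideanSpace ℝ (Fin N)) 1)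
  have hV : 0 ≤ V := measureReal_nonneg
  set s := Metric.closedBall y (R / 2 ^ i) ∩ Metric.closedBall z (R / 2 ^ l) with hs
  have hzero : ∀ x, x ∉ s → |f x| ^ (p - 1) * |g x| = 0 := by
    intro x hx
    by_cases h : x ∈ Metric.closedBall y (R / 2 ^ i)
    · rw [hg0 x fun h' => hx ⟨h, h'⟩, abs_zero, mul_zero]
    · rw [hf0 x h, abs_zero, Real.zero_rpow (by linarith), zero_mul]
  rcases s.eq_empty_or_nonempty with h | ⟨x, hx⟩
  · have : ∀ x, |f x| ^ (p - 1) * |g x| = 0 := fun x => hzero x (by simp [h])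
    simp only [this, integral_zero]
    positivity
  have hvol (n : ℕ) (c : EuclideanSpace ℝ (Fin N)) :
      volume.real (Metric.closedBall c (R / 2 ^ n)) = R ^ N * V * (1 / (2 : ℝ) ^ n) ^ N := by
    rw [Measure.addHaar_real_closedBall' _ _ (by positivity), finrank_euclideanSpace,
      Fintype.card_fin, div_eq_mul_one_div, mul_pow]
    ring
  have hvs : volume.real s ≤
      R ^ N * V * min ((1 / (2 : ℝ) ^ i) ^ N) ((1 / (2 : ℝ) ^ l) ^ N) := by
    rw [mul_min_of_nonneg _ _ (by positivity), ← hvol i y, ← hvol l z]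
    exact le_min (measureReal_mono Set.inter_subset_left measure_closedBall_lt_top.ne)
      (measureReal_mono Set.inter_subset_right measure_closedBall_lt_top.ne)
  have hfin : volume s < ⊤ :=
    (measure_mono Set.inter_subset_left).trans_lt measure_closedBall_lt_top
  have hint : ∫ x, |f x| ^ (p - 1) * |g x| ≤
      ((2 : ℝ) ^ (i * a) * M) ^ (p - 1) * ((2 : ℝ) ^ (l * a) * M) * volume.real s := by
    rw [← setIntegral_eq_integral_of_forall_compl_eq_zero hzero]
    refine (Real.le_norm_self _).trans (norm_setIntegral_le_of_norm_le_const hfin fun x _ => ?_)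
    rw [Real.norm_of_nonneg (by positivity)]
    exact mul_le_mul (Real.rpow_le_rpow (abs_nonneg _) (hf x) (by linarith)) (hg x)
      (abs_nonneg _) (by positivity)
  have hdec : S / (4 * R + 1) ≤ (2 : ℝ) ^ |(l : ℝ) - i| := by
    rw [div_le_iff₀' (by positivity)]
    exact decoupling_le_of_closedBall_inter hR i l hx.1 hx.2
  refine hint.trans ((mul_le_mul_of_nonneg_left hvs (by positivity)).trans ?_)
  calc _ = M ^ (p - 1) * M * R ^ N * V * (((2 : ℝ) ^ (i * a)) ^ (p - 1) * (2 : ℝ) ^ (l * a) *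
        min ((1 / (2 : ℝ) ^ i) ^ N) ((1 / (2 : ℝ) ^ l) ^ N)) := by
        rw [Real.mul_rpow (by positivity) hM]; ring
    _ ≤ _ := mul_le_mul_of_nonneg_left ((two_rpow_mul_min_le ha hp hpa i l).trans
        (Real.rpow_le_rpow_of_nonpos (by positivity) hdec (by linarith))) (by positivity)

/-- the decoupling-of-supports claim from the proof of Proposition 3.4 in
ℝ^N: for asymptotically decoupled bubbles, the critical mass of a finite sum of bubbles is
asymptotically the sum of the masses. -/
theorem struwe_solimini_stmt13 (N : ℕ) (hN : 3 ≤ N) (r : ℝ) (hr : 0 < r)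
    (χ : EuclideanSpace ℝ (Fin N) → ℝ) (hχsm : ContDiff ℝ (⊤ : ℕ∞) χ) (hχc : HasCompactSupport χ)
    (hχ01 : ∀ x, 0 ≤ χ x ∧ χ x ≤ 1)
    (hχ1 : ∀ x : EuclideanSpace ℝ (Fin N), ‖x‖ ≤ r / 2 → χ x = 1)
    (hχ0 : ∀ x : EuclideanSpace ℝ (Fin N), r ≤ ‖x‖ → χ x = 0)
    (ν : ℕ) (w : Fin ν → EuclideanSpace ℝ (Fin N) → ℝ)
    (hwcont : ∀ n, Continuous (w n)) (hwsupp : ∀ n, HasCompactSupport (w n))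
    (j : Fin ν → ℕ → ℕ) (hj : ∀ n, Tendsto (j n) atTop atTop)
    (y : Fin ν → ℕ → EuclideanSpace ℝ (Fin N))
    (hdec : ∀ n n' : Fin ν, n ≠ n' →
      Tendsto (fun k => |(j n' k : ℝ) - (j n k : ℝ)| +
          ((2 : ℝ) ^ (j n' k) + (2 : ℝ) ^ (j n k)) * ‖y n k - y n' k‖) atTop atTop)
    (W : Fin ν → ℕ → EuclideanSpace ℝ (Fin N) → ℝ)
    (hW : ∀ n k x, W n k x = (2 : ℝ) ^ ((j n k : ℝ) * (((N : ℝ) - 2) / 2)) * χ (x - y n k) *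
        w n ((2 : ℝ) ^ (j n k) • (x - y n k))) :
    Tendsto (fun k =>
        (∫ x, |∑ n : Fin ν, W n k x| ^ ((2 * (N : ℝ)) / ((N : ℝ) - 2))) -
        ∑ n : Fin ν, ∫ x, |W n k x| ^ ((2 * (N : ℝ)) / ((N : ℝ) - 2)))
      atTop (𝓝 0) := by
  have hN' : (3 : ℝ) ≤ N := by exact_mod_cast hN
  set p : ℝ := (2 * (N : ℝ)) / ((N : ℝ) - 2) with hpdef
  set a : ℝ := ((N : ℝ) - 2) / 2 with hadef
  have ha : 0 < a := by rw [hadef]; linarith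
  have hp : 2 ≤ p := by rw [hpdef, le_div_iff₀ (by linarith)]; linarith
  have hpa : p * a = N := by
    have : (N : ℝ) - 2 ≠ 0 := by linarith
    rw [hpdef, hadef]; field_simp
  obtain ⟨M, hM, hwM⟩ : ∃ M : ℝ, 0 ≤ M ∧ ∀ n x, |w n x| ≤ M := by
    choose C hC using fun n => (hwsupp n).exists_bound_of_continuous (hwcont n)
    refine ⟨∑ n, |C n|, Finset.sum_nonneg fun _ _ => abs_nonneg _, fun n x => ?_⟩
    exact ((hC n x).trans (le_abs_self _)).trans
      (Finset.single_le_sum (f := fun n => |C n|) (fun _ _ => abs_nonneg _) (Finset.mem_univ n))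
  obtain ⟨R, hR, hwR⟩ : ∃ R : ℝ, 0 ≤ R ∧ ∀ n x, R < ‖x‖ → w n x = 0 := by
    choose C hC using fun n => (hwsupp n).isCompact.isBounded.exists_norm_le
    refine ⟨∑ n, |C n|, Finset.sum_nonneg fun _ _ => abs_nonneg _, fun n x hx => ?_⟩
    by_contra h
    have h1 := hC n x (subset_tsupport _ h)
    have h2 := Finset.single_le_sum (f := fun n => |C n|) (fun _ _ => abs_nonneg _)
      (Finset.mem_univ n)
    have h3 := le_abs_self (C n)
    linarith
  have hWle (n k x) : |W n k x| ≤ (2 : ℝ) ^ (j n k * a) * M := by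
    rw [hW, abs_mul, abs_mul, abs_of_nonneg (hχ01 _).1, abs_of_nonneg (by positivity)]
    refine mul_le_mul ?_ (hwM _ _) (abs_nonneg _) (by positivity)
    exact mul_le_of_le_one_right (by positivity) (hχ01 _).2
  have hW0 (n k x) (hx : x ∉ Metric.closedBall (y n k) (R / 2 ^ j n k)) : W n k x = 0 := by
    rw [hW, hwR n _ _, mul_zero]
    rw [norm_smul, Real.norm_of_nonneg (by positivity), ← div_lt_iff₀' (by positivity),
      ← dist_eq_norm]
    simpa using hx
  have hWcont (n k) : Continuous (W n k) := by
    have hχcont := hχsm.continuous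
    have hwc := hwcont n
    rw [show W n k = _ from funext (hW n k)]
    fun_prop
  have hWsupp (n k) : HasCompactSupport (W n k) :=
    HasCompactSupport.intro (isCompact_closedBall _ _) (hW0 n k)
  have hi1 (n k) : Integrable (fun x => |W n k x| ^ p) :=
    ((hWcont n k).abs.rpow_const fun _ => Or.inr (by linarith)).integrable_of_hasCompactSupport
      ((hWsupp n k).comp_left (g := fun t : ℝ => |t| ^ p) (by
        simp [Real.zero_rpow (show p ≠ 0 by linarith)]))
  have hi2 (k) : Integrable (fun x => |∑ n, W n k x| ^ p) := by
    refine ((continuous_finsetSum _ fun n _ => hWcont n k).abs.rpow_const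
      fun _ => Or.inr (by linarith)).integrable_of_hasCompactSupport ?_
    refine HasCompactSupport.intro
      (isCompact_iUnion fun n => isCompact_closedBall (y n k) (R / 2 ^ j n k)) fun x hx => ?_
    rw [Finset.sum_eq_zero fun n _ => hW0 n k x fun h => hx (Set.mem_iUnion.2 ⟨n, h⟩), abs_zero,
      Real.zero_rpow (by linarith)]
  have hi3 (m n k) : Integrable (fun x => |W m k x| ^ (p - 1) * |W n k x|) := by
    have hc := (hWcont m k).abs.rpow_const (p := p - 1) fun _ => Or.inr (by linarith)
    exact (hc.mul (hWcont n k).abs).integrable_of_hasCompactSupport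
      (HasCompactSupport.mul_left (hWsupp n k).abs)
  have hmixed (m n) (hmn : m ≠ n) :
      Tendsto (fun k => ∫ x, |W m k x| ^ (p - 1) * |W n k x|) atTop (𝓝 0) := by
    have hS := hdec m n hmn
    have hlim := ((tendsto_rpow_neg_atTop ha).comp
      (hS.atTop_div_const (show 0 < 4 * R + 1 by positivity))).const_mul
      (M ^ (p - 1) * M * R ^ N *
        volume.real (Metric.closedBall (0 : EuclideanSpace ℝ (Fin N)) 1))
    rw [mul_zero] at hlim
    refine squeeze_zero' (Eventually.of_forall fun k => integral_nonneg fun x => by positivity)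
      ?_ hlim
    filter_upwards [hS.eventually_gt_atTop 0] with k hk
    exact integral_mixed_bubbles_le ha.le hp hpa hR hM _ _ _ _ (hWle m k) (hWle n k)
      (hW0 m k) (hW0 n k) hk
  have hlim : Tendsto (fun k => (p * (Fintype.card (Fin ν) : ℝ) ^ (p - 1) + 1) *
      ∑ m, ∑ n ∈ Finset.univ.erase m, ∫ x, |W m k x| ^ (p - 1) * |W n k x|) atTop (𝓝 0) := by
    have := (tendsto_finsetSum Finset.univ fun m _ =>
      tendsto_finsetSum (Finset.univ.erase m) fun n hn =>
        hmixed m n (Finset.ne_of_mem_erase hn).symm).const_mul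
      (p * (Fintype.card (Fin ν) : ℝ) ^ (p - 1) + 1)
    simpa using this
  refine squeeze_zero_norm (fun k => ?_) hlim
  rw [← integral_finsetSum _ fun n _ => hi1 n k,
    ← integral_sub (hi2 k) (integrable_finsetSum _ fun n _ => hi1 n k)]
  have hi4 (m) : Integrable (fun x =>
      ∑ n ∈ Finset.univ.erase m, |W m k x| ^ (p - 1) * |W n k x|) :=
    integrable_finsetSum _ fun n _ => hi3 m n k
  refine (norm_integral_le_of_norm_le
    ((integrable_finsetSum Finset.univ fun m _ => hi4 m).const_mul _)
    (Eventually.of_forall fun x =>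
      abs_abs_sum_rpow_sub_sum_abs_rpow_le (by linarith) fun n => W n k x)).trans (le_of_eq ?_)
  rw [integral_const_mul, integral_finsetSum _ fun m _ => hi4 m]
  simp_rw [integral_finsetSum _ fun n _ => hi3 _ n k]
end
end
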